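/- Let γ = (γ₁, γ₂) : ℝ → ℝ² be a smooth curve with γ₁'(s) ≠ 0 and γ₂'(s) ≠ 0 for all s (so its tangent is nowhere parallel to the x- or y-axis), and let n(s) denote a smooth Euclidean unit normal vector field along γ. Let φ₁, φ₂, ψ₁, ψ₂ : ℝ → ℝ be smooth, and fix s₀ ∈ ℝ with φ₁(s₀) + φ₂(s₀) ≠ 0. Then there exist an open neighborhood Ω ⊆ ℝ² of γ(s₀) and smooth functions u, v : Ω → ℝ with u + v nowhere zero on Ω, satisfying the lightcone wave map system u_{xy} = u_x u_y/(u+v), v_{xy} = v_x v_y/(u+v) on Ω and the Cauchy conditions u(γ(s)) = φ₁(s), v(γ(s)) = φ₂(s), (∂u/∂n)(γ(s)) = ψ₁(s), (∂v/∂n)(γ(s)) = ψ₂(s) for all s with γ(s) ∈ Ω; moreover this solution is unique, in the sense that any two such solutions agree on a neighborhood of γ(s₀). -/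

import Mathlib

/-- Partial derivative with respect to the first variable `x`. -/
noncomputable def pdx (f : ℝ × ℝ → ℝ) (p : ℝ × ℝ) : ℝ :=
  deriv (fun x => f (x, p.2)) p.1

/-- Partial derivative with respect to the second variable `y`. -/
noncomputable def pdy (f : ℝ × ℝ → ℝ) (p : ℝ × ℝ) : ℝ :=
  deriv (fun y => f (p.1, y)) p.2

/-- `(u, v)` is a local solution on the open set `Ω` of the Cauchy problem for the
lightcone wave map system with data `φ₁, φ₂, ψ₁, ψ₂` along the curve `γ` with unit
normal `n`. -/
def IsCauchySolution (γ n : ℝ → ℝ × ℝ) (φ₁ φ₂ ψ₁ ψ₂ : ℝ → ℝ)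
    (Ω : Set (ℝ × ℝ)) (u v : ℝ × ℝ → ℝ) : Prop :=
  ContDiffOn ℝ (⊤ : ℕ∞) u Ω ∧ ContDiffOn ℝ (⊤ : ℕ∞) v Ω ∧
  (∀ p ∈ Ω, u p + v p ≠ 0) ∧
  (∀ p ∈ Ω, pdx (pdy u) p = pdx u p * pdy u p / (u p + v p)) ∧
  (∀ p ∈ Ω, pdx (pdy v) p = pdx v p * pdy v p / (u p + v p)) ∧
  (∀ s : ℝ, γ s ∈ Ω →
    u (γ s) = φ₁ s ∧ v (γ s) = φ₂ s ∧
    (n s).1 * pdx u (γ s) + (n s).2 * pdy u (γ s) = ψ₁ s ∧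
    (n s).1 * pdx v (γ s) + (n s).2 * pdy v (γ s) = ψ₂ s)

open Set Filter Topology
open scoped ContDiff

section OneVariable

lemma exists_contDiff_antideriv {f : ℝ → ℝ} (hf : ContDiff ℝ ∞ f) :
    ∃ F : ℝ → ℝ, ContDiff ℝ ∞ F ∧ ∀ s, HasDerivAt F (f s) s := by
  have hF : ∀ s, HasDerivAt (fun u => ∫ x in (0 : ℝ)..u, f x) (f s) s := fun s =>
    (hf.continuous.integral_hasStrictDerivAt 0 s).hasDerivAt
  refine ⟨_, contDiff_infty_iff_deriv.2 ⟨fun s => (hF s).differentiableAt, ?_⟩, hF⟩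
  rwa [funext fun s => (hF s).deriv]

lemma exists_contDiff_local_inv {w : ℝ → ℝ} (hw : ContDiff ℝ ∞ w) {s₀ : ℝ} (h₀ : w s₀ ≠ 0) :
    ∃ κ : ℝ → ℝ, ContDiff ℝ ∞ κ ∧ ∃ ε > 0, ∀ s ∈ Metric.ball s₀ ε, κ s * w s = 1 := by
  obtain ⟨ε, hε, hball⟩ := Metric.eventually_nhds_iff_ball.1
    (hw.continuous.continuousAt.eventually_ne h₀)
  let χ : ContDiffBump s₀ := ⟨ε / 2, ε, half_pos hε, half_lt_self hε⟩
  have hpos : ∀ s, w s ^ 2 + (1 - χ s) ≠ 0 := by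
    intro s
    have h1 := χ.le_one (x := s)
    by_cases hs : s ∈ Metric.ball s₀ ε
    · have := sq_pos_of_ne_zero (hball s hs)
      linarith
    · have h0 : χ s = 0 := χ.zero_of_le_dist (by simpa using hs)
      have := sq_nonneg (w s)
      linarith
  refine ⟨fun s => w s / (w s ^ 2 + (1 - χ s)),
    hw.div ((hw.pow 2).add (contDiff_const.sub χ.contDiff)) hpos, ε / 2, half_pos hε, ?_⟩
  intro s hs
  have h1 : χ s = 1 := χ.one_of_mem_closedBall (Metric.ball_subset_closedBall hs)
  have hne : w s ≠ 0 := hball s (Metric.ball_subset_ball (half_le_self hε.le) hs)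
  simp only [h1]
  field_simp
  ring

/-- A smooth function on `ℝ` with nowhere vanishing derivative has a smooth inverse,
defined on its open range. -/
lemma exists_contDiffOn_inverse {g : ℝ → ℝ} (hg : ContDiff ℝ ∞ g) (h' : ∀ s, deriv g s ≠ 0) :
    ∃ X : ℝ → ℝ, IsOpen (range g) ∧ ContDiffOn ℝ ∞ X (range g) ∧ (∀ s, X (g s) = s) ∧
      ∀ s, HasDerivAt X (deriv g s)⁻¹ (g s) := by
  have hinj : Function.Injective g := by
    intro a b hab
    by_contra hne
    rcases lt_or_gt_of_ne hne with h | h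
    · obtain ⟨c, -, hc⟩ := exists_deriv_eq_zero h hg.continuous.continuousOn hab
      exact h' c hc
    · obtain ⟨c, -, hc⟩ := exists_deriv_eq_zero h hg.continuous.continuousOn hab.symm
      exact h' c hc
  have hopen : IsOpenMap g := isOpenMap_of_hasStrictDerivAt
    (fun s => hg.contDiffAt.hasStrictDerivAt (by simp)) h'
  have hemb := IsOpenEmbedding.of_continuous_injective_isOpenMap hg.continuous hinj hopen
  let e := hemb.toOpenPartialHomeomorph g
  have hleft : ∀ s, e.symm (g s) = s := fun s => e.left_inv (by simp [e])
  have dg : ∀ s, HasDerivAt g (deriv g s) s := fun s =>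
    (hg.differentiable (by simp) s).hasDerivAt
  refine ⟨e.symm, hemb.isOpen_range, ?_, hleft, fun s => ?_⟩
  · rintro _ ⟨s, rfl⟩
    refine (e.contDiffAt_symm_deriv (f₀' := deriv g s) (h' s) (by simp [e]) ?_
      hg.contDiffAt).contDiffWithinAt
    rw [hleft]
    exact dg s
  · refine e.hasDerivAt_symm (by simp [e]) (h' s) ?_
    rw [hleft]
    exact dg s

/-- The one-variable functions from which a solution with prescribed Cauchy data on the diagonal
is built: the solution is `u = b(s) - α(s) ℓ(t) + r(t)`, `u + v = (l(s) - ℓ(t)) (α(s) - a(t))`. -/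
lemma exists_profile {P A Q B φ₁ φ₂ : ℝ → ℝ} (hP : ContDiff ℝ ∞ P) (hA : ContDiff ℝ ∞ A)
    (hQ : ContDiff ℝ ∞ Q) (hφ₁ : ContDiff ℝ ∞ φ₁) (hφ₂ : ContDiff ℝ ∞ φ₂)
    (h₁ : ∀ s, deriv φ₁ s = P s + A s) (h₂ : ∀ s, deriv φ₂ s = Q s + B s)
    {s₀ : ℝ} (h₀ : φ₁ s₀ + φ₂ s₀ ≠ 0) :
    ∃ (J : Set ℝ) (α l b ℓ a r : ℝ → ℝ), IsOpen J ∧ s₀ ∈ J ∧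
      ContDiff ℝ ∞ α ∧ ContDiff ℝ ∞ l ∧ ContDiff ℝ ∞ b ∧
      ContDiff ℝ ∞ ℓ ∧ ContDiff ℝ ∞ a ∧ ContDiff ℝ ∞ r ∧
      (∀ s, deriv b s = deriv α s * l s) ∧ (∀ s, deriv r s = a s * deriv ℓ s) ∧
      ∀ s ∈ J, deriv α s * (l s - ℓ s) = P s ∧ -deriv ℓ s * (α s - a s) = A s ∧
        deriv l s * (α s - a s) = Q s ∧ -deriv a s * (l s - ℓ s) = B s ∧
        (l s - ℓ s) * (α s - a s) = φ₁ s + φ₂ s ∧ b s - α s * ℓ s + r s = φ₁ s := by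
  obtain ⟨κ, hκ, ε, hε, hκw⟩ := exists_contDiff_local_inv (hφ₁.add hφ₂) h₀
  obtain ⟨Φ, hΦ, dΦ⟩ := exists_contDiff_antideriv ((hA.add hQ).mul hκ)
  obtain ⟨f, hf, hf0, df⟩ : ∃ f : ℝ → ℝ, ContDiff ℝ ∞ f ∧ (∀ s, f s ≠ 0) ∧
      ∀ s, HasDerivAt f (f s * ((A s + Q s) * κ s)) s :=
    ⟨fun s => Real.exp (Φ s), hΦ.exp, fun s => Real.exp_ne_zero _, fun s => (dΦ s).exp⟩
  obtain ⟨α, hα, dα⟩ := exists_contDiff_antideriv (f := fun s => P s / f s) (hP.div hf hf0)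
  obtain ⟨l, hl, dl⟩ := exists_contDiff_antideriv ((hQ.mul hf).mul hκ)
  obtain ⟨b, hb, db⟩ := exists_contDiff_antideriv
    (f := fun s => P s / f s * l s) ((hP.div hf hf0).mul hl)
  have hw : ContDiff ℝ ∞ fun s => φ₁ s + φ₂ s := hφ₁.add hφ₂
  have hg : ContDiff ℝ ∞ fun s => (φ₁ s + φ₂ s) / f s := hw.div hf hf0
  have dφ₁ : ∀ s, HasDerivAt φ₁ (P s + A s) s := fun s => by
    rw [← h₁]
    exact (hφ₁.differentiable (by simp) s).hasDerivAt
  have dφ₂ : ∀ s, HasDerivAt φ₂ (Q s + B s) s := fun s => by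
    rw [← h₂]
    exact (hφ₂.differentiable (by simp) s).hasDerivAt
  have dℓ : ∀ s, HasDerivAt (fun s => l s - f s) (-(A s * f s * κ s)) s := fun s =>
    ((dl s).sub (df s)).congr_deriv (by ring)
  have da : ∀ s ∈ Metric.ball s₀ ε,
      HasDerivAt (fun s => α s - (φ₁ s + φ₂ s) / f s) (-(B s / f s)) s := fun s hs => by
    refine ((dα s).sub (((dφ₁ s).add (dφ₂ s)).div (df s) (hf0 s))).congr_deriv ?_
    have h := hκw s hs
    have := hf0 s
    simp only [Pi.add_apply] at h ⊢
    field_simp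
    linear_combination (A s + Q s) * h
  obtain ⟨r, hr, dr⟩ := exists_contDiff_antideriv
    (f := fun s => (α s - (φ₁ s + φ₂ s) / f s) * (-(A s * f s * κ s)))
    ((hα.sub hg).mul ((hA.mul hf).mul hκ).neg)
  refine ⟨Metric.ball s₀ ε, α, l, b, fun s => l s - f s, fun s => α s - (φ₁ s + φ₂ s) / f s,
    fun s => r s + (φ₁ s₀ - (b s₀ - α s₀ * (l s₀ - f s₀) + r s₀)), Metric.isOpen_ball,
    Metric.mem_ball_self hε, hα, hl, hb, hl.sub hf, hα.sub hg, hr.add contDiff_const,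
    fun s => ?_, fun s => ?_, fun s hs => ⟨?_, ?_, ?_, ?_, ?_, ?_⟩⟩
  · rw [(db s).deriv, (dα s).deriv]
  · rw [((dr s).add_const _).deriv, (dℓ s).deriv]
  · have := hf0 s
    rw [(dα s).deriv]
    field_simp
    ring
  · have h := hκw s hs
    have := hf0 s
    rw [(dℓ s).deriv]
    field_simp
    linear_combination A s * h
  · have h := hκw s hs
    have := hf0 s
    rw [(dl s).deriv]
    field_simp
    linear_combination Q s * h
  · have := hf0 s
    rw [(da s hs).deriv]
    field_simp
    ring
  · have := hf0 s
    field_simp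
    ring
  · have dF : ∀ x ∈ Metric.ball s₀ ε, HasDerivAt
        (fun s => b s - α s * (l s - f s) + r s - φ₁ s) 0 x := fun x hx => by
      refine ((((db x).sub ((dα x).mul (dℓ x))).add (dr x)).sub (dφ₁ x)).congr_deriv ?_
      have h := hκw x hx
      have := hf0 x
      field_simp
      linear_combination A x * f x * h
    have hc := Metric.isOpen_ball.is_const_of_deriv_eq_zero
      (convex_ball s₀ ε).isPreconnected
      (fun x hx => (dF x hx).differentiableAt.differentiableWithinAt)
      (fun x hx => (dF x hx).deriv) hs (Metric.mem_ball_self hε)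
    linear_combination hc

end OneVariable

section Existence

/-- The first component `u` of the explicit solution. -/
def profileU (α b ℓ r : ℝ → ℝ) (p : ℝ × ℝ) : ℝ :=
  b p.1 - α p.1 * ℓ p.2 + r p.2

/-- The second component `v` of the explicit solution. -/
def profileV (α l b ℓ a r : ℝ → ℝ) (p : ℝ × ℝ) : ℝ :=
  (l p.1 - ℓ p.2) * (α p.1 - a p.2) - profileU α b ℓ r p

variable {α l b ℓ a r : ℝ → ℝ} {x y α' l' ℓ' a' : ℝ}

lemma pdx_profileU (hα : HasDerivAt α α' x) (hb : HasDerivAt b (α' * l x) x) :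
    pdx (profileU α b ℓ r) (x, y) = α' * (l x - ℓ y) := by
  have h : HasDerivAt (fun x => profileU α b ℓ r (x, y)) (α' * (l x - ℓ y)) x :=
    ((hb.sub (hα.mul_const (ℓ y))).add_const (r y)).congr_deriv (by ring)
  exact h.deriv

lemma pdy_profileU (hℓ : HasDerivAt ℓ ℓ' y) (hr : HasDerivAt r (a y * ℓ') y) :
    pdy (profileU α b ℓ r) (x, y) = -ℓ' * (α x - a y) := by
  have h : HasDerivAt (fun y => profileU α b ℓ r (x, y)) (-ℓ' * (α x - a y)) y :=
    (((hℓ.const_mul (α x)).const_sub (b x)).add hr).congr_deriv (by ring)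
  exact h.deriv

lemma pdx_profileV (hα : HasDerivAt α α' x) (hl : HasDerivAt l l' x)
    (hb : HasDerivAt b (α' * l x) x) :
    pdx (profileV α l b ℓ a r) (x, y) = l' * (α x - a y) := by
  have h : HasDerivAt (fun x => profileV α l b ℓ a r (x, y)) (l' * (α x - a y)) x :=
    (((hl.sub_const (ℓ y)).mul (hα.sub_const (a y))).sub
      ((hb.sub (hα.mul_const (ℓ y))).add_const (r y))).congr_deriv (by ring)
  exact h.deriv

lemma pdy_profileV (hℓ : HasDerivAt ℓ ℓ' y) (ha : HasDerivAt a a' y)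
    (hr : HasDerivAt r (a y * ℓ') y) :
    pdy (profileV α l b ℓ a r) (x, y) = -a' * (l x - ℓ y) := by
  have h : HasDerivAt (fun y => profileV α l b ℓ a r (x, y)) (-a' * (l x - ℓ y)) y :=
    (((hℓ.const_sub (l x)).mul (ha.const_sub (α x))).sub
      (((hℓ.const_mul (α x)).const_sub (b x)).add hr)).congr_deriv (by ring)
  exact h.deriv

lemma pdx_pdy_profileU (hα : HasDerivAt α α' x) (hℓ : HasDerivAt ℓ ℓ' y)
    (hr : HasDerivAt r (a y * ℓ') y) :
    pdx (pdy (profileU α b ℓ r)) (x, y) = -ℓ' * α' := by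
  simp only [pdx, pdy_profileU hℓ hr]
  exact ((hα.sub_const (a y)).const_mul (-ℓ')).deriv

lemma pdx_pdy_profileV (hl : HasDerivAt l l' x) (hℓ : HasDerivAt ℓ ℓ' y)
    (ha : HasDerivAt a a' y) (hr : HasDerivAt r (a y * ℓ') y) :
    pdx (pdy (profileV α l b ℓ a r)) (x, y) = -a' * l' := by
  simp only [pdx, pdy_profileV hℓ ha hr]
  exact ((hl.sub_const (ℓ y)).const_mul (-a')).deriv

/-- Local existence when the values and the gradients of `u` and `v` are prescribed along the
curve `s ↦ (g s, h s)`. -/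
theorem exists_solution_of_gradient {g h : ℝ → ℝ} (hg : ContDiff ℝ ∞ g) (hh : ContDiff ℝ ∞ h)
    (hg' : ∀ s, deriv g s ≠ 0) (hh' : ∀ s, deriv h s ≠ 0)
    {φ₁ φ₂ ux uy vx vy : ℝ → ℝ} (hφ₁ : ContDiff ℝ ∞ φ₁) (hφ₂ : ContDiff ℝ ∞ φ₂)
    (hux : ContDiff ℝ ∞ ux) (huy : ContDiff ℝ ∞ uy) (hvx : ContDiff ℝ ∞ vx)
    (h₁ : ∀ s, deriv φ₁ s = ux s * deriv g s + uy s * deriv h s)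
    (h₂ : ∀ s, deriv φ₂ s = vx s * deriv g s + vy s * deriv h s)
    {s₀ : ℝ} (h₀ : φ₁ s₀ + φ₂ s₀ ≠ 0) :
    ∃ (Ω : Set (ℝ × ℝ)) (u v : ℝ × ℝ → ℝ), IsOpen Ω ∧ (g s₀, h s₀) ∈ Ω ∧
      ContDiffOn ℝ ∞ u Ω ∧ ContDiffOn ℝ ∞ v Ω ∧ (∀ p ∈ Ω, u p + v p ≠ 0) ∧
      (∀ p ∈ Ω, pdx (pdy u) p = pdx u p * pdy u p / (u p + v p)) ∧
      (∀ p ∈ Ω, pdx (pdy v) p = pdx v p * pdy v p / (u p + v p)) ∧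
      ∀ s, (g s, h s) ∈ Ω → u (g s, h s) = φ₁ s ∧ v (g s, h s) = φ₂ s ∧
        pdx u (g s, h s) = ux s ∧ pdy u (g s, h s) = uy s ∧
        pdx v (g s, h s) = vx s ∧ pdy v (g s, h s) = vy s := by
  have hdg : ContDiff ℝ ∞ (deriv g) := (contDiff_infty_iff_deriv.1 hg).2
  have hdh : ContDiff ℝ ∞ (deriv h) := (contDiff_infty_iff_deriv.1 hh).2
  obtain ⟨X, hI, hX, hXg, dX⟩ := exists_contDiffOn_inverse hg hg'
  obtain ⟨Y, hI', hY, hYh, dY⟩ := exists_contDiffOn_inverse hh hh'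
  obtain ⟨J, α, l, b, ℓ, a, r, hJ, hs₀, hα, hl, hb, hℓ, ha, hr, db, dr, hdiag⟩ :=
    exists_profile (hux.mul hdg) (huy.mul hdh) (hvx.mul hdg) hφ₁ hφ₂ h₁ h₂ h₀
  have dcX : ∀ {f : ℝ → ℝ}, ContDiff ℝ ∞ f → ∀ s,
      HasDerivAt (f ∘ X) (deriv f s * (deriv g s)⁻¹) (g s) := fun {f} hf s => by
    refine HasDerivAt.comp (g s) ?_ (dX s)
    rw [hXg]
    exact (hf.differentiable (by simp) s).hasDerivAt
  have dcY : ∀ {f : ℝ → ℝ}, ContDiff ℝ ∞ f → ∀ s,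
      HasDerivAt (f ∘ Y) (deriv f s * (deriv h s)⁻¹) (h s) := fun {f} hf s => by
    refine HasDerivAt.comp (h s) ?_ (dY s)
    rw [hYh]
    exact (hf.differentiable (by simp) s).hasDerivAt
  have dbX : ∀ s, HasDerivAt (b ∘ X) (deriv α s * (deriv g s)⁻¹ * (l ∘ X) (g s)) (g s) :=
    fun s => (dcX hb s).congr_deriv (by simp only [db, Function.comp, hXg]; ring)
  have drY : ∀ s, HasDerivAt (r ∘ Y) ((a ∘ Y) (h s) * (deriv ℓ s * (deriv h s)⁻¹)) (h s) :=
    fun s => (dcY hr s).congr_deriv (by simp only [dr, Function.comp, hYh]; ring)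
  have cX : ∀ {f : ℝ → ℝ}, ContDiff ℝ ∞ f →
      ContDiffOn ℝ ∞ (fun p : ℝ × ℝ => (f ∘ X) p.1) (range g ×ˢ range h) := fun hf =>
    (hf.comp_contDiffOn hX).comp contDiff_fst.contDiffOn fun p hp => hp.1
  have cY : ∀ {f : ℝ → ℝ}, ContDiff ℝ ∞ f →
      ContDiffOn ℝ ∞ (fun p : ℝ × ℝ => (f ∘ Y) p.2) (range g ×ˢ range h) := fun hf =>
    (hf.comp_contDiffOn hY).comp contDiff_snd.contDiffOn fun p hp => hp.2
  have hu : ContDiffOn ℝ ∞ (profileU (α ∘ X) (b ∘ X) (ℓ ∘ Y) (r ∘ Y)) (range g ×ˢ range h) :=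
    ((cX hb).sub ((cX hα).mul (cY hℓ))).add (cY hr)
  have hw : ContDiffOn ℝ ∞
      (fun p : ℝ × ℝ => ((l ∘ X) p.1 - (ℓ ∘ Y) p.2) * ((α ∘ X) p.1 - (a ∘ Y) p.2))
      (range g ×ˢ range h) :=
    ((cX hl).sub (cY hℓ)).mul ((cX hα).sub (cY ha))
  have hv : ContDiffOn ℝ ∞ (profileV (α ∘ X) (l ∘ X) (b ∘ X) (ℓ ∘ Y) (a ∘ Y) (r ∘ Y))
      (range g ×ˢ range h) := hw.sub hu
  have hwne := hw.continuousOn.isOpen_inter_preimage (t := {0}ᶜ) (hI.prod hI')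
    isOpen_compl_singleton
  have hXJ : IsOpen ((range g ∩ X ⁻¹' J) ×ˢ (univ : Set ℝ)) :=
    (hX.continuousOn.isOpen_inter_preimage hI hJ).prod isOpen_univ
  refine ⟨_, profileU (α ∘ X) (b ∘ X) (ℓ ∘ Y) (r ∘ Y),
    profileV (α ∘ X) (l ∘ X) (b ∘ X) (ℓ ∘ Y) (a ∘ Y) (r ∘ Y), hwne.inter hXJ, ?_,
    hu.mono fun p hp => hp.1.1, hv.mono fun p hp => hp.1.1, ?_, ?_, ?_, ?_⟩
  · refine ⟨⟨⟨⟨s₀, rfl⟩, ⟨s₀, rfl⟩⟩, ?_⟩, ⟨⟨s₀, rfl⟩, ?_⟩, mem_univ _⟩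
    · simpa [hXg, hYh, (hdiag s₀ hs₀).2.2.2.2.1] using h₀
    · simpa [hXg] using hs₀
  · rintro p ⟨⟨-, hp⟩, -⟩
    simpa [profileV] using hp
  · rintro ⟨_, _⟩ ⟨⟨⟨⟨s, rfl⟩, ⟨t, rfl⟩⟩, hp⟩, -⟩
    rw [pdx_pdy_profileU (dcX hα s) (dcY hℓ t) (drY t), pdx_profileU (dcX hα s) (dbX s),
      pdy_profileU (dcY hℓ t) (drY t), profileV, add_sub_cancel, eq_div_iff hp]
    ring
  · rintro ⟨_, _⟩ ⟨⟨⟨⟨s, rfl⟩, ⟨t, rfl⟩⟩, hp⟩, -⟩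
    rw [pdx_pdy_profileV (dcX hl s) (dcY hℓ t) (dcY ha t) (drY t),
      pdx_profileV (dcX hα s) (dcX hl s) (dbX s),
      pdy_profileV (dcY hℓ t) (dcY ha t) (drY t), profileV, add_sub_cancel, eq_div_iff hp]
    ring
  · rintro s ⟨-, ⟨-, hsJ⟩, -⟩
    rw [mem_preimage, hXg] at hsJ
    obtain ⟨e1, e2, e3, e4, e5, e6⟩ := hdiag s hsJ
    have hgs := hg' s
    have hhs := hh' s
    rw [pdx_profileU (dcX hα s) (dbX s), pdy_profileU (dcY hℓ s) (drY s),
      pdx_profileV (dcX hα s) (dcX hl s) (dbX s),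
      pdy_profileV (dcY hℓ s) (dcY ha s) (drY s)]
    simp only [profileV, profileU, Function.comp, hXg, hYh]
    refine ⟨e6, by linear_combination e5 - e6, ?_, ?_, ?_, ?_⟩
    · field_simp
      linear_combination e1
    · field_simp
      linear_combination e2
    · field_simp
      linear_combination e3
    · field_simp
      linear_combination e4

end Existence

section Uniqueness

lemma hasDerivAt_pdx {f : ℝ × ℝ → ℝ} {p : ℝ × ℝ} (hf : DifferentiableAt ℝ f p) :
    HasDerivAt (fun x => f (x, p.2)) (pdx f p) p.1 :=
  (hf.comp p.1 (f := fun x => (x, p.2))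
    (differentiableAt_id.prodMk (differentiableAt_const _))).hasDerivAt

lemma hasDerivAt_pdy {f : ℝ × ℝ → ℝ} {p : ℝ × ℝ} (hf : DifferentiableAt ℝ f p) :
    HasDerivAt (fun y => f (p.1, y)) (pdy f p) p.2 :=
  (hf.comp p.2 (f := fun y => (p.1, y))
    ((differentiableAt_const _).prodMk differentiableAt_id)).hasDerivAt

lemma pdx_eq_fderiv {f : ℝ × ℝ → ℝ} {p : ℝ × ℝ} (hf : DifferentiableAt ℝ f p) :
    pdx f p = fderiv ℝ f p (1, 0) :=
  (hf.hasFDerivAt.comp_hasDerivAt p.1 (f := fun x => (x, p.2))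
    ((hasDerivAt_id _).prodMk (hasDerivAt_const _ _))).deriv

lemma pdy_eq_fderiv {f : ℝ × ℝ → ℝ} {p : ℝ × ℝ} (hf : DifferentiableAt ℝ f p) :
    pdy f p = fderiv ℝ f p (0, 1) :=
  (hf.hasFDerivAt.comp_hasDerivAt p.2 (f := fun y => (p.1, y))
    ((hasDerivAt_const _ _).prodMk (hasDerivAt_id _))).deriv

lemma ContDiffAt.eventually_differentiableAt {f : ℝ × ℝ → ℝ} {p : ℝ × ℝ}
    (hf : ContDiffAt ℝ ∞ f p) : ∀ᶠ q in 𝓝 p, DifferentiableAt ℝ f q :=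
  ((hf.of_le (m := 1) (by exact_mod_cast le_top)).eventually (by simp)).mono
    fun _ hq => hq.differentiableAt (by simp)

lemma contDiffAt_pdx {f : ℝ × ℝ → ℝ} {p : ℝ × ℝ} (hf : ContDiffAt ℝ ∞ f p) :
    ContDiffAt ℝ ∞ (pdx f) p :=
  ((hf.fderiv_right (m := ∞) (by simp)).clm_apply contDiffAt_const).congr_of_eventuallyEq
    (hf.eventually_differentiableAt.mono fun _ hq => pdx_eq_fderiv hq)

lemma contDiffAt_pdy {f : ℝ × ℝ → ℝ} {p : ℝ × ℝ} (hf : ContDiffAt ℝ ∞ f p) :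
    ContDiffAt ℝ ∞ (pdy f) p :=
  ((hf.fderiv_right (m := ∞) (by simp)).clm_apply contDiffAt_const).congr_of_eventuallyEq
    (hf.eventually_differentiableAt.mono fun _ hq => pdy_eq_fderiv hq)

lemma pdy_pdx_comm {f : ℝ × ℝ → ℝ} {p : ℝ × ℝ} (hf : ContDiffAt ℝ ∞ f p) :
    pdy (pdx f) p = pdx (pdy f) p := by
  have h2 : DifferentiableAt ℝ (fderiv ℝ f) p :=
    (hf.fderiv_right (m := ∞) (by simp)).differentiableAt (by simp)
  have hx : pdx f =ᶠ[𝓝 p] fun q => fderiv ℝ f q (1, 0) :=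
    hf.eventually_differentiableAt.mono fun _ hq => pdx_eq_fderiv hq
  have hy : pdy f =ᶠ[𝓝 p] fun q => fderiv ℝ f q (0, 1) :=
    hf.eventually_differentiableAt.mono fun _ hq => pdy_eq_fderiv hq
  have hsymm : IsSymmSndFDerivAt ℝ f p := hf.isSymmSndFDerivAt (by
    rw [minSmoothness_of_isRCLikeNormedField]
    exact WithTop.coe_le_coe.2 le_top)
  rw [pdy_eq_fderiv ((contDiffAt_pdx hf).differentiableAt (by simp)),
    pdx_eq_fderiv ((contDiffAt_pdy hf).differentiableAt (by simp)), hx.fderiv_eq, hy.fderiv_eq,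
    fderiv_clm_apply h2 (differentiableAt_const _), fderiv_clm_apply h2 (differentiableAt_const _)]
  simpa using hsymm (0, 1) (1, 0)

/-- A vector-valued function vanishing on the diagonal, each of whose components has one partial
derivative controlled by the norm of the function, vanishes near each point of the diagonal. -/
lemma eventually_eq_zero_of_partial_bound {ι : Type*} [Fintype ι] {D : ℝ × ℝ → ι → ℝ} {s₀ L : ℝ}
    {N : Set (ℝ × ℝ)} (hN : N ∈ 𝓝 (s₀, s₀)) (hD : ContinuousOn D N)
    (hdiag : ∀ s, (s, s) ∈ N → D (s, s) = 0)
    (hder : ∀ i,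
      (∀ z ∈ N, ∃ d, HasDerivAt (fun s => D (s, z.2) i) d z.1 ∧ |d| ≤ L * ‖D z‖) ∨
      (∀ z ∈ N, ∃ d, HasDerivAt (fun t => D (z.1, t) i) d z.2 ∧ |d| ≤ L * ‖D z‖)) :
    ∀ᶠ z in 𝓝 (s₀, s₀), D z = 0 := by
  obtain ⟨ρ, hρ, hball⟩ := Metric.nhds_basis_closedBall.mem_iff.1 hN
  set ε := min ρ (1 / (4 * (|L| + 1)))
  have hL : 0 < |L| + 1 := by positivity
  have hε : 0 < ε := lt_min hρ (by positivity)
  have hεL : |L| * (2 * ε) ≤ 1 / 2 := by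
    have h1 : ε ≤ 1 / (4 * (|L| + 1)) := min_le_right _ _
    rw [le_div_iff₀ (by positivity)] at h1
    nlinarith [abs_nonneg L]
  have hS : Metric.closedBall s₀ ε ×ˢ Metric.closedBall s₀ ε ⊆ N := by
    rw [closedBall_prod_same]
    exact (Metric.closedBall_subset_closedBall (min_le_left _ _)).trans hball
  have hcomp : IsCompact (Metric.closedBall s₀ ε ×ˢ Metric.closedBall s₀ ε) :=
    (isCompact_closedBall _ _).prod (isCompact_closedBall _ _)
  have hmem : s₀ ∈ Metric.closedBall s₀ ε := Metric.mem_closedBall_self hε.le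
  have hconv : Convex ℝ (Metric.closedBall s₀ ε) := convex_closedBall _ _
  obtain ⟨⟨s, t⟩, hz, hmax⟩ := hcomp.exists_isMaxOn ⟨(s₀, s₀), hmem, hmem⟩ (hD.mono hS).norm
  have hst : ‖s - t‖ ≤ 2 * ε := by
    have := dist_triangle_right s t s₀
    have h1 := Metric.mem_closedBall.1 hz.1
    have h2 := Metric.mem_closedBall.1 hz.2
    rw [Real.dist_eq] at this
    rw [Real.norm_eq_abs]
    linarith
  have hbound : ∀ z ∈ Metric.closedBall s₀ ε ×ˢ Metric.closedBall s₀ ε,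
      L * ‖D z‖ ≤ |L| * ‖D (s, t)‖ := fun z hz =>
    mul_le_mul (le_abs_self L) (hmax hz) (norm_nonneg _) (abs_nonneg _)
  have hcomponent : ∀ i, ‖D (s, t) i‖ ≤ |L| * ‖D (s, t)‖ * ‖s - t‖ := by
    intro i
    rcases hder i with h | h
    · choose! d hd hdL using h
      have := hconv.norm_image_sub_le_of_norm_hasDerivWithin_le
        (f := fun s => D (s, t) i) (f' := fun s => d (s, t)) (C := |L| * ‖D (s, t)‖)
        (fun x hx => (hd (x, t) (hS ⟨hx, hz.2⟩)).hasDerivWithinAt)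
        (fun x hx => (hdL (x, t) (hS ⟨hx, hz.2⟩)).trans (hbound (x, t) ⟨hx, hz.2⟩)) hz.2 hz.1
      simpa [hdiag t (hS ⟨hz.2, hz.2⟩)] using this
    · choose! d hd hdL using h
      have := hconv.norm_image_sub_le_of_norm_hasDerivWithin_le
        (f := fun t => D (s, t) i) (f' := fun t => d (s, t)) (C := |L| * ‖D (s, t)‖)
        (fun x hx => (hd (s, x) (hS ⟨hz.1, hx⟩)).hasDerivWithinAt)
        (fun x hx => (hdL (s, x) (hS ⟨hz.1, hx⟩)).trans (hbound (s, x) ⟨hz.1, hx⟩)) hz.1 hz.2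
      rw [norm_sub_rev s t]
      simpa [hdiag s (hS ⟨hz.1, hz.1⟩)] using this
  have hM : ‖D (s, t)‖ ≤ |L| * ‖D (s, t)‖ * ‖s - t‖ :=
    (pi_norm_le_iff_of_nonneg (by positivity)).2 hcomponent
  have hM0 : ‖D (s, t)‖ ≤ 0 := by
    have h1 : |L| * ‖s - t‖ ≤ 1 / 2 :=
      (mul_le_mul_of_nonneg_left hst (abs_nonneg L)).trans hεL
    nlinarith [norm_nonneg (D (s, t))]
  have hnhds : Metric.closedBall s₀ ε ×ˢ Metric.closedBall s₀ ε ∈ 𝓝 (s₀, s₀) :=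
    prod_mem_nhds (Metric.closedBall_mem_nhds _ hε) (Metric.closedBall_mem_nhds _ hε)
  filter_upwards [hnhds] with z hz
  exact norm_le_zero_iff.1 ((hmax hz).trans hM0)

/-- The values and first partial derivatives of `u` and `v` at a point. -/
noncomputable def firstJet (u v : ℝ × ℝ → ℝ) (p : ℝ × ℝ) : Fin 6 → ℝ :=
  ![u p, v p, pdx u p, pdx v p, pdy u p, pdy v p]

lemma continuousAt_firstJet {u v : ℝ × ℝ → ℝ} {p : ℝ × ℝ} (hu : ContDiffAt ℝ ∞ u p)
    (hv : ContDiffAt ℝ ∞ v p) : ContinuousAt (firstJet u v) p := by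
  refine continuousAt_pi.2 fun i => ?_
  fin_cases i
  exacts [hu.continuousAt, hv.continuousAt, (contDiffAt_pdx hu).continuousAt,
    (contDiffAt_pdx hv).continuousAt, (contDiffAt_pdy hu).continuousAt,
    (contDiffAt_pdy hv).continuousAt]

/-- Two solutions with the same first jet along the curve `s ↦ (g s, h s)` agree near it. -/
theorem eventually_eq_of_firstJet_eq {g h : ℝ → ℝ} (hg : ContDiff ℝ ∞ g) (hh : ContDiff ℝ ∞ h)
    {s₀ : ℝ} (hg' : deriv g s₀ ≠ 0) (hh' : deriv h s₀ ≠ 0)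
    {Ω : Set (ℝ × ℝ)} (hΩ : IsOpen Ω) (hmem : (g s₀, h s₀) ∈ Ω) {u v u' v' : ℝ × ℝ → ℝ}
    (hu : ContDiffOn ℝ ∞ u Ω) (hv : ContDiffOn ℝ ∞ v Ω)
    (hu' : ContDiffOn ℝ ∞ u' Ω) (hv' : ContDiffOn ℝ ∞ v' Ω)
    (hw : u (g s₀, h s₀) + v (g s₀, h s₀) ≠ 0)
    (eu : ∀ p ∈ Ω, pdx (pdy u) p = pdx u p * pdy u p / (u p + v p))
    (ev : ∀ p ∈ Ω, pdx (pdy v) p = pdx v p * pdy v p / (u p + v p))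
    (eu' : ∀ p ∈ Ω, pdx (pdy u') p = pdx u' p * pdy u' p / (u' p + v' p))
    (ev' : ∀ p ∈ Ω, pdx (pdy v') p = pdx v' p * pdy v' p / (u' p + v' p))
    (hjet : ∀ s, (g s, h s) ∈ Ω → firstJet u v (g s, h s) = firstJet u' v' (g s, h s)) :
    ∀ᶠ p in 𝓝 (g s₀, h s₀), u p = u' p ∧ v p = v' p := by
  have at_of_on : ∀ {f : ℝ × ℝ → ℝ}, ContDiffOn ℝ ∞ f Ω → ∀ p ∈ Ω, ContDiffAt ℝ ∞ f p :=
    fun hf p hp => hf.contDiffAt (hΩ.mem_nhds hp)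
  have cu := at_of_on hu
  have cv := at_of_on hv
  have cu' := at_of_on hu'
  have cv' := at_of_on hv'
  have dg : ∀ s, HasDerivAt g (deriv g s) s := fun s =>
    (hg.differentiable (by simp) s).hasDerivAt
  have dh : ∀ s, HasDerivAt h (deriv h s) s := fun s =>
    (hh.differentiable (by simp) s).hasDerivAt
  let G : ℝ × ℝ → ℝ × ℝ := fun z => (g z.1, h z.2)
  have hG : Continuous G := (hg.continuous.comp continuous_fst).prodMk
    (hh.continuous.comp continuous_snd)
  have hlip : ∀ i j : Fin 6, ∃ K, ∃ T ∈ 𝓝 (firstJet u v (g s₀, h s₀)),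
      LipschitzOnWith K (fun z : Fin 6 → ℝ => z i * z j / (z 0 + z 1)) T := fun i j => by
    refine ContDiffAt.exists_lipschitzOnWith (𝕂 := ℝ) (ContDiffAt.div ?_ ?_ ?_)
    · fun_prop
    · fun_prop
    · simpa [firstJet] using hw
  obtain ⟨K₁, T₁, hT₁, lip₁⟩ := hlip 2 4
  obtain ⟨K₂, T₂, hT₂, lip₂⟩ := hlip 3 5
  set C := max (|deriv g s₀| + 1) (|deriv h s₀| + 1)
  have hC0 : 0 ≤ C := le_max_of_le_left (by positivity)
  let N : Set (ℝ × ℝ) := {z | G z ∈ Ω ∧ firstJet u v (G z) ∈ T₁ ∩ T₂ ∧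
    firstJet u' v' (G z) ∈ T₁ ∩ T₂ ∧ |deriv g z.1| ≤ C ∧ |deriv h z.2| ≤ C}
  have hN : N ∈ 𝓝 (s₀, s₀) := by
    have hT : T₁ ∩ T₂ ∈ 𝓝 (firstJet u v (g s₀, h s₀)) := inter_mem hT₁ hT₂
    have hT' := hT
    rw [hjet s₀ hmem] at hT'
    have c1 : ContinuousAt (fun z => firstJet u v (G z)) (s₀, s₀) :=
      (continuousAt_firstJet (cu _ hmem) (cv _ hmem)).comp (f := G) (x := (s₀, s₀)) hG.continuousAt
    have c2 : ContinuousAt (fun z => firstJet u' v' (G z)) (s₀, s₀) :=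
      (continuousAt_firstJet (cu' _ hmem) (cv' _ hmem)).comp (f := G) (x := (s₀, s₀)) hG.continuousAt
    have c3 : Continuous fun z : ℝ × ℝ => |deriv g z.1| :=
      ((contDiff_infty_iff_deriv.1 hg).2.continuous.comp continuous_fst).abs
    have c4 : Continuous fun z : ℝ × ℝ => |deriv h z.2| :=
      ((contDiff_infty_iff_deriv.1 hh).2.continuous.comp continuous_snd).abs
    filter_upwards [hG.continuousAt.preimage_mem_nhds (hΩ.mem_nhds hmem), c1 hT, c2 hT',
      c3.continuousAt.eventually_lt_const (u := C)
        ((lt_add_one _).trans_le (le_max_left _ _)),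
      c4.continuousAt.eventually_lt_const (u := C)
        ((lt_add_one _).trans_le (le_max_right _ _))] with z h1 h2 h3 h4 h5
    exact ⟨h1, h2, h3, h4.le, h5.le⟩
  have ds : ∀ {f f' : ℝ × ℝ → ℝ}, (∀ p ∈ Ω, ContDiffAt ℝ ∞ f p) →
      (∀ p ∈ Ω, ContDiffAt ℝ ∞ f' p) → ∀ z ∈ N,
      HasDerivAt (fun s => f (g s, h z.2) - f' (g s, h z.2))
        ((pdx f (G z) - pdx f' (G z)) * deriv g z.1) z.1 := fun hf hf' z hz =>
    (((hasDerivAt_pdx ((hf _ hz.1).differentiableAt (by simp))).sub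
      (hasDerivAt_pdx ((hf' _ hz.1).differentiableAt (by simp)))).comp z.1 (dg z.1))
  have dt : ∀ {f f' : ℝ × ℝ → ℝ}, (∀ p ∈ Ω, ContDiffAt ℝ ∞ f p) →
      (∀ p ∈ Ω, ContDiffAt ℝ ∞ f' p) → ∀ z ∈ N,
      HasDerivAt (fun t => f (g z.1, h t) - f' (g z.1, h t))
        ((pdy f (G z) - pdy f' (G z)) * deriv h z.2) z.2 := fun hf hf' z hz =>
    (((hasDerivAt_pdy ((hf _ hz.1).differentiableAt (by simp))).sub
      (hasDerivAt_pdy ((hf' _ hz.1).differentiableAt (by simp)))).comp z.2 (dh z.2))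
  let D : ℝ × ℝ → Fin 6 → ℝ := fun z => firstJet u v (G z) - firstJet u' v' (G z)
  have hK₁ := K₁.coe_nonneg
  have hK₂ := K₂.coe_nonneg
  have bound : ∀ {k c e M : ℝ}, k ≤ 1 + K₁ + K₂ → |c| ≤ C → 0 ≤ M → |e| ≤ k * M →
      |e * c| ≤ (1 + K₁ + K₂) * C * M := fun {k c e M} hk hc hM he => by
    rw [abs_mul]
    calc |e| * |c| ≤ ((1 + K₁ + K₂) * M) * C :=
          mul_le_mul (he.trans (mul_le_mul_of_nonneg_right hk hM)) hc (abs_nonneg _)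
            (by positivity)
      _ = _ := by ring
  have b0 : ∀ z (i : Fin 6), |D z i| ≤ 1 * ‖D z‖ := fun z i => by
    rw [one_mul]
    exact norm_le_pi_norm (D z) i
  have bu : ∀ z ∈ N, |pdx (pdy u) (G z) - pdx (pdy u') (G z)| ≤ K₁ * ‖D z‖ := fun z hz => by
    rw [eu _ hz.1, eu' _ hz.1]
    exact lip₁.norm_sub_le hz.2.1.1 hz.2.2.1.1
  have bv : ∀ z ∈ N, |pdx (pdy v) (G z) - pdx (pdy v') (G z)| ≤ K₂ * ‖D z‖ := fun z hz => by
    rw [ev _ hz.1, ev' _ hz.1]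
    exact lip₂.norm_sub_le hz.2.1.2 hz.2.2.1.2
  have hzero : ∀ᶠ z in 𝓝 (s₀, s₀), D z = 0 := by
    refine eventually_eq_zero_of_partial_bound (L := (1 + K₁ + K₂) * C) hN ?_
      (fun s hs => sub_eq_zero.2 (hjet s hs.1)) ?_
    · intro z hz
      exact (((continuousAt_firstJet (cu _ hz.1) (cv _ hz.1)).comp hG.continuousAt).sub
        ((continuousAt_firstJet (cu' _ hz.1) (cv' _ hz.1)).comp
          hG.continuousAt)).continuousWithinAt
    · intro i
      fin_cases i
      · exact .inl fun z hz => ⟨_, ds cu cu' z hz,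
          bound (by linarith) hz.2.2.2.1 (norm_nonneg _) (b0 z 2)⟩
      · exact .inl fun z hz => ⟨_, ds cv cv' z hz,
          bound (by linarith) hz.2.2.2.1 (norm_nonneg _) (b0 z 3)⟩
      · refine .inr fun z hz => ⟨_, dt (fun p hp => contDiffAt_pdx (cu p hp))
          (fun p hp => contDiffAt_pdx (cu' p hp)) z hz,
          bound (k := K₁) (by linarith) hz.2.2.2.2 (norm_nonneg _) ?_⟩
        rw [pdy_pdx_comm (cu _ hz.1), pdy_pdx_comm (cu' _ hz.1)]
        exact bu z hz
      · refine .inr fun z hz => ⟨_, dt (fun p hp => contDiffAt_pdx (cv p hp))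
          (fun p hp => contDiffAt_pdx (cv' p hp)) z hz,
          bound (k := K₂) (by linarith) hz.2.2.2.2 (norm_nonneg _) ?_⟩
        rw [pdy_pdx_comm (cv _ hz.1), pdy_pdx_comm (cv' _ hz.1)]
        exact bv z hz
      · exact .inl fun z hz => ⟨_, ds (fun p hp => contDiffAt_pdy (cu p hp))
          (fun p hp => contDiffAt_pdy (cu' p hp)) z hz,
          bound (k := K₁) (by linarith) hz.2.2.2.1 (norm_nonneg _) (bu z hz)⟩
      · exact .inl fun z hz => ⟨_, ds (fun p hp => contDiffAt_pdy (cv p hp))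
          (fun p hp => contDiffAt_pdy (cv' p hp)) z hz,
          bound (k := K₂) (by linarith) hz.2.2.2.1 (norm_nonneg _) (bv z hz)⟩
  have hmap : 𝓝 (g s₀, h s₀) = map G (𝓝 (s₀, s₀)) := by
    rw [nhds_prod_eq, nhds_prod_eq,
      ← (hg.contDiffAt.hasStrictDerivAt (by simp)).map_nhds_eq hg',
      ← (hh.contDiffAt.hasStrictDerivAt (by simp)).map_nhds_eq hh', prod_map_map_eq]
  rw [hmap, eventually_map]
  filter_upwards [hzero] with z hz
  exact ⟨sub_eq_zero.1 (congrFun hz 0), sub_eq_zero.1 (congrFun hz 1)⟩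

end Uniqueness

/-- Along a curve with unit normal `n`, the gradient is determined by the tangential and normal
derivatives. -/
lemma gradient_eq_of_tangential_normal {g h n₁ n₂ X Y φ ψ : ℝ} (hg : g ≠ 0)
    (hunit : n₁ ^ 2 + n₂ ^ 2 = 1) (hperp : n₁ * g + n₂ * h = 0)
    (htan : X * g + Y * h = φ) (hnor : n₁ * X + n₂ * Y = ψ) :
    X = φ * g / (g ^ 2 + h ^ 2) + ψ * n₁ ∧ Y = φ * h / (g ^ 2 + h ^ 2) + ψ * n₂ := by
  have hN : g ^ 2 + h ^ 2 ≠ 0 := by positivity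
  have h1 : (g ^ 2 + h ^ 2) * n₁ ^ 2 = h ^ 2 := by
    linear_combination h ^ 2 * hunit + (n₁ * g - n₂ * h) * hperp
  have h2 : (g ^ 2 + h ^ 2) * (n₁ * n₂) = -(g * h) := by
    linear_combination (n₂ * g + n₁ * h) * hperp - g * h * hunit
  have h3 : (g ^ 2 + h ^ 2) * n₂ ^ 2 = g ^ 2 := by
    linear_combination g ^ 2 * hunit + (n₂ * h - n₁ * g) * hperp
  subst htan hnor
  constructor
  · field_simp
    linear_combination -X * h1 - Y * h2
  · field_simp
    linear_combination -Y * h3 - X * h2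

lemma pdx_mul_add_pdy_mul_eq_deriv {γ : ℝ → ℝ × ℝ} {f : ℝ × ℝ → ℝ} {φ : ℝ → ℝ} {s : ℝ}
    {Ω : Set (ℝ × ℝ)} (hΩ : IsOpen Ω) (hs : γ s ∈ Ω) (hγ : DifferentiableAt ℝ γ s)
    (hf : ContDiffOn ℝ ∞ f Ω) (hφ : ∀ t, γ t ∈ Ω → f (γ t) = φ t) :
    pdx f (γ s) * (deriv γ s).1 + pdy f (γ s) * (deriv γ s).2 = deriv φ s := by
  have hd : DifferentiableAt ℝ f (γ s) :=
    (hf.contDiffAt (hΩ.mem_nhds hs)).differentiableAt (by simp)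
  have hev : φ =ᶠ[𝓝 s] f ∘ γ := by
    filter_upwards [hγ.continuousAt.preimage_mem_nhds (hΩ.mem_nhds hs)] with t ht
    exact (hφ t ht).symm
  rw [hev.deriv_eq, (hd.hasFDerivAt.comp_hasDerivAt s hγ.hasDerivAt).deriv, pdx_eq_fderiv hd,
    pdy_eq_fderiv hd]
  have : deriv γ s = (deriv γ s).1 • ((1 : ℝ), (0 : ℝ)) + (deriv γ s).2 • ((0 : ℝ), (1 : ℝ)) := by
    ext <;> simp
  conv_rhs => rw [this, map_add, map_smul, map_smul]
  simp only [smul_eq_mul]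
  ring

/-- The first jet of a solution along the curve is determined by the Cauchy data. -/
lemma IsCauchySolution.firstJet_eq {γ n : ℝ → ℝ × ℝ} {φ₁ φ₂ ψ₁ ψ₂ : ℝ → ℝ}
    {Ω : Set (ℝ × ℝ)} {u v : ℝ × ℝ → ℝ} (hsol : IsCauchySolution γ n φ₁ φ₂ ψ₁ ψ₂ Ω u v)
    (hΩ : IsOpen Ω) {s : ℝ} (hs : γ s ∈ Ω) (hγ : DifferentiableAt ℝ γ s)
    (hγ1 : (deriv γ s).1 ≠ 0) (hunit : (n s).1 ^ 2 + (n s).2 ^ 2 = 1)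
    (hperp : (n s).1 * (deriv γ s).1 + (n s).2 * (deriv γ s).2 = 0) :
    firstJet u v (γ s) = ![φ₁ s, φ₂ s,
      deriv φ₁ s * (deriv γ s).1 / ((deriv γ s).1 ^ 2 + (deriv γ s).2 ^ 2) + ψ₁ s * (n s).1,
      deriv φ₂ s * (deriv γ s).1 / ((deriv γ s).1 ^ 2 + (deriv γ s).2 ^ 2) + ψ₂ s * (n s).1,
      deriv φ₁ s * (deriv γ s).2 / ((deriv γ s).1 ^ 2 + (deriv γ s).2 ^ 2) + ψ₁ s * (n s).2,
      deriv φ₂ s * (deriv γ s).2 / ((deriv γ s).1 ^ 2 + (deriv γ s).2 ^ 2) + ψ₂ s * (n s).2] := by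
  obtain ⟨hu, hv, -, -, -, hdata⟩ := hsol
  obtain ⟨e1, e2, e3, e4⟩ := hdata s hs
  obtain ⟨ux, uy⟩ := gradient_eq_of_tangential_normal hγ1 hunit hperp
    (pdx_mul_add_pdy_mul_eq_deriv hΩ hs hγ hu fun t ht => (hdata t ht).1) e3
  obtain ⟨vx, vy⟩ := gradient_eq_of_tangential_normal hγ1 hunit hperp
    (pdx_mul_add_pdy_mul_eq_deriv hΩ hs hγ hv fun t ht => (hdata t ht).2.1) e4
  rw [firstJet, e1, e2, ux, uy, vx, vy]

/-- local existence and uniqueness for the Cauchy problem for the lightcone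
wave map system, with smooth data along a smooth curve whose tangent is nowhere parallel
to either coordinate axis, at a point where `φ₁ + φ₂ ≠ 0`. -/
theorem cauchy_problem_local_existence_uniqueness
    (γ : ℝ → ℝ × ℝ) (hγ : ContDiff ℝ (⊤ : ℕ∞) γ)
    (hγ1 : ∀ s : ℝ, (deriv γ s).1 ≠ 0) (hγ2 : ∀ s : ℝ, (deriv γ s).2 ≠ 0)
    (n : ℝ → ℝ × ℝ) (hn : ContDiff ℝ (⊤ : ℕ∞) n)
    (hunit : ∀ s : ℝ, (n s).1 ^ 2 + (n s).2 ^ 2 = 1)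
    (hperp : ∀ s : ℝ, (n s).1 * (deriv γ s).1 + (n s).2 * (deriv γ s).2 = 0)
    (φ₁ φ₂ ψ₁ ψ₂ : ℝ → ℝ)
    (hφ₁ : ContDiff ℝ (⊤ : ℕ∞) φ₁) (hφ₂ : ContDiff ℝ (⊤ : ℕ∞) φ₂)
    (hψ₁ : ContDiff ℝ (⊤ : ℕ∞) ψ₁) (hψ₂ : ContDiff ℝ (⊤ : ℕ∞) ψ₂)
    (s₀ : ℝ) (hs₀ : φ₁ s₀ + φ₂ s₀ ≠ 0) :
    ∃ (Ω : Set (ℝ × ℝ)) (u v : ℝ × ℝ → ℝ),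
      IsOpen Ω ∧ γ s₀ ∈ Ω ∧
      IsCauchySolution γ n φ₁ φ₂ ψ₁ ψ₂ Ω u v ∧
      -- uniqueness: any two such local solutions agree near `γ s₀`
      (∀ (Ω' : Set (ℝ × ℝ)) (u' v' : ℝ × ℝ → ℝ),
        IsOpen Ω' → γ s₀ ∈ Ω' →
        IsCauchySolution γ n φ₁ φ₂ ψ₁ ψ₂ Ω' u' v' →
        ∃ Ω'' : Set (ℝ × ℝ), IsOpen Ω'' ∧ γ s₀ ∈ Ω'' ∧
          ∀ p ∈ Ω'', u p = u' p ∧ v p = v' p) := by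
  have dγ : ∀ s, DifferentiableAt ℝ γ s := hγ.differentiable (by simp)
  have hg : ContDiff ℝ ∞ fun s => (γ s).1 := hγ.fst
  have hh : ContDiff ℝ ∞ fun s => (γ s).2 := hγ.snd
  have dg : ∀ s, deriv (fun s => (γ s).1) s = (deriv γ s).1 := fun s =>
    ((ContinuousLinearMap.fst ℝ ℝ ℝ).hasFDerivAt.comp_hasDerivAt s (dγ s).hasDerivAt).deriv
  have dh : ∀ s, deriv (fun s => (γ s).2) s = (deriv γ s).2 := fun s =>
    ((ContinuousLinearMap.snd ℝ ℝ ℝ).hasFDerivAt.comp_hasDerivAt s (dγ s).hasDerivAt).deriv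
  have hdγ : ContDiff ℝ ∞ (deriv γ) := (contDiff_infty_iff_deriv.1 hγ).2
  have hN : ∀ s, (deriv γ s).1 ^ 2 + (deriv γ s).2 ^ 2 ≠ 0 := fun s => by
    have := hγ1 s
    positivity
  have hNs : ContDiff ℝ ∞ fun s => (deriv γ s).1 ^ 2 + (deriv γ s).2 ^ 2 :=
    (hdγ.fst.pow 2).add (hdγ.snd.pow 2)
  have hx : ∀ {φ ψ : ℝ → ℝ}, ContDiff ℝ ∞ φ → ContDiff ℝ ∞ ψ → ContDiff ℝ ∞ fun s =>
      deriv φ s * (deriv γ s).1 / ((deriv γ s).1 ^ 2 + (deriv γ s).2 ^ 2) + ψ s * (n s).1 :=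
    fun hφ hψ => (((contDiff_infty_iff_deriv.1 hφ).2.mul hdγ.fst).div hNs hN).add
      (hψ.mul hn.fst)
  have hy : ∀ {φ ψ : ℝ → ℝ}, ContDiff ℝ ∞ φ → ContDiff ℝ ∞ ψ → ContDiff ℝ ∞ fun s =>
      deriv φ s * (deriv γ s).2 / ((deriv γ s).1 ^ 2 + (deriv γ s).2 ^ 2) + ψ s * (n s).2 :=
    fun hφ hψ => (((contDiff_infty_iff_deriv.1 hφ).2.mul hdγ.snd).div hNs hN).add
      (hψ.mul hn.snd)
  have tangential : ∀ (φ ψ : ℝ → ℝ) s, deriv φ s =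
      (deriv φ s * (deriv γ s).1 / ((deriv γ s).1 ^ 2 + (deriv γ s).2 ^ 2) + ψ s * (n s).1) *
        deriv (fun s => (γ s).1) s +
      (deriv φ s * (deriv γ s).2 / ((deriv γ s).1 ^ 2 + (deriv γ s).2 ^ 2) + ψ s * (n s).2) *
        deriv (fun s => (γ s).2) s := fun φ ψ s => by
    have := hN s
    rw [dg, dh]
    field_simp
    linear_combination (-ψ s * ((deriv γ s).1 ^ 2 + (deriv γ s).2 ^ 2)) * hperp s
  have normal : ∀ (φ ψ : ℝ → ℝ) s,
      (n s).1 * (deriv φ s * (deriv γ s).1 / ((deriv γ s).1 ^ 2 + (deriv γ s).2 ^ 2) +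
        ψ s * (n s).1) +
      (n s).2 * (deriv φ s * (deriv γ s).2 / ((deriv γ s).1 ^ 2 + (deriv γ s).2 ^ 2) +
        ψ s * (n s).2) = ψ s := fun φ ψ s => by
    have := hN s
    field_simp
    linear_combination ψ s * ((deriv γ s).1 ^ 2 + (deriv γ s).2 ^ 2) * hunit s +
      deriv φ s * hperp s
  obtain ⟨Ω, u, v, hΩ, hmem, hu, hv, hw, eu, ev, hdata⟩ :=
    exists_solution_of_gradient hg hh (fun s => (dg s).trans_ne (hγ1 s))
      (fun s => (dh s).trans_ne (hγ2 s)) hφ₁ hφ₂ (hx hφ₁ hψ₁) (hy hφ₁ hψ₁) (hx hφ₂ hψ₂)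
      (tangential φ₁ ψ₁) (tangential φ₂ ψ₂) hs₀
  have hsol : IsCauchySolution γ n φ₁ φ₂ ψ₁ ψ₂ Ω u v := by
    refine ⟨hu, hv, hw, eu, ev, fun s hs => ?_⟩
    obtain ⟨e1, e2, e3, e4, e5, e6⟩ := hdata s hs
    refine ⟨e1, e2, ?_, ?_⟩
    · rw [e3, e4]
      exact normal φ₁ ψ₁ s
    · rw [e5, e6]
      exact normal φ₂ ψ₂ s
  refine ⟨Ω, u, v, hΩ, hmem, hsol, fun Ω' u' v' hΩ' hmem' hsol' => ?_⟩
  have hagree := eventually_eq_of_firstJet_eq hg hh ((dg s₀).trans_ne (hγ1 s₀))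
    ((dh s₀).trans_ne (hγ2 s₀)) (hΩ.inter hΩ') ⟨hmem, hmem'⟩
    (hu.mono inter_subset_left) (hv.mono inter_subset_left)
    (hsol'.1.mono inter_subset_right) (hsol'.2.1.mono inter_subset_right) (hw _ hmem)
    (fun p hp => eu p hp.1) (fun p hp => ev p hp.1)
    (fun p hp => hsol'.2.2.2.1 p hp.2) (fun p hp => hsol'.2.2.2.2.1 p hp.2)
    (fun s hs => (hsol.firstJet_eq hΩ hs.1 (dγ s) (hγ1 s) (hunit s) (hperp s)).trans
      (hsol'.firstJet_eq hΩ' hs.2 (dγ s) (hγ1 s) (hunit s) (hperp s)).symm)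
  obtain ⟨Ω'', hsub, hopen, hin⟩ := eventually_nhds_iff.1 hagree
  exact ⟨Ω'', hopen, hin, hsub⟩
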